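/- arXiv:1704.00715 — 2 statements merged into one kernel-verified Lean document; each statement's English description precedes it below -/
import Mathlib

section
/- For any BMSC W with finite output alphabet, the minus bulk convolutional polar transform satisfies Z(W^{-̂}) ≤ 4·Z(W). -/
open Finset

section Channels

variable {Y Y₁ Y₂ : Type*}

/-- A binary-input channel with finite output alphabet: nonnegative entries,
each row summing to one. -/
def IsChannel [Fintype Y] (W : ZMod 2 → Y → ℝ) : Prop :=
  (∀ x y, 0 ≤ W x y) ∧ ∀ x, ∑ y, W x y = 1

/-- A binary-input memoryless symmetric channel (BMSC): a channel admitting an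
involution of the output alphabet exchanging the two conditional distributions. -/
def IsBMSC [Fintype Y] (W : ZMod 2 → Y → ℝ) : Prop :=
  IsChannel W ∧ ∃ π : Y → Y, Function.Involutive π ∧ ∀ y, W 1 y = W 0 (π y)

/-- The Bhattacharyya parameter of a binary-input channel. -/
noncomputable def Zparam [Fintype Y] (W : ZMod 2 → Y → ℝ) : ℝ :=
  ∑ y, Real.sqrt (W 0 y * W 1 y)

/-- The symmetric capacity of a binary-input channel. -/
noncomputable def capacity [Fintype Y] (W : ZMod 2 → Y → ℝ) : ℝ :=
  ∑ x : ZMod 2, ∑ y, (1 / 2) * W x y *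
    Real.logb 2 (W x y / ((1 / 2) * (W 0 y + W 1 y)))

/-- The minus polar transform ⟨W₁,W₂⟩⁻. -/
noncomputable def polarMinus [Fintype Y₁] [Fintype Y₂] (W₁ : ZMod 2 → Y₁ → ℝ)
    (W₂ : ZMod 2 → Y₂ → ℝ) : ZMod 2 → Y₁ × Y₂ → ℝ :=
  fun u₁ y => (1 / 2) * ∑ u₂ : ZMod 2, W₁ (u₁ + u₂) y.1 * W₂ u₂ y.2

/-- The plus polar transform ⟨W₁,W₂⟩⁺, with output (y₁, y₂, u₁). -/
noncomputable def polarPlus [Fintype Y₁] [Fintype Y₂] (W₁ : ZMod 2 → Y₁ → ℝ)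
    (W₂ : ZMod 2 → Y₂ → ℝ) : ZMod 2 → Y₁ × Y₂ × ZMod 2 → ℝ :=
  fun u₂ y => (1 / 2) * W₁ (y.2.2 + u₂) y.1 * W₂ u₂ y.2.1

end Channels

/-- The minus bulk convolutional polar transform W^{-̂} = ⟨W⁻, W⁺⟩⁻. -/
noncomputable def convMinus {Y : Type*} [Fintype Y] (W : ZMod 2 → Y → ℝ) :
    ZMod 2 → (Y × Y) × (Y × Y × ZMod 2) → ℝ :=
  polarMinus (polarMinus W W) (polarPlus W W)

/-- The plus bulk convolutional polar transform W^{+̂} = ⟨W⁻, W⁺⟩⁺. -/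
noncomputable def convPlus {Y : Type*} [Fintype Y] (W : ZMod 2 → Y → ℝ) :
    ZMod 2 → (Y × Y) × (Y × Y × ZMod 2) × ZMod 2 → ℝ :=
  polarPlus (polarMinus W W) (polarPlus W W)

/-- A sum over the two binary inputs. -/
theorem sum_zmod_two (f : ZMod 2 → ℝ) : ∑ u, f u = f 0 + f 1 :=
  Fin.sum_univ_two f

theorem IsChannel.polarMinus {Y₁ Y₂ : Type*} [Fintype Y₁] [Fintype Y₂]
    {W₁ : ZMod 2 → Y₁ → ℝ} {W₂ : ZMod 2 → Y₂ → ℝ} (h₁ : IsChannel W₁) (h₂ : IsChannel W₂) :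
    IsChannel (polarMinus W₁ W₂) := by
  refine ⟨fun u y => mul_nonneg (by norm_num) (sum_nonneg fun v _ =>
    mul_nonneg (h₁.1 _ _) (h₂.1 _ _)), fun u => ?_⟩
  simp only [_root_.polarMinus, ← mul_sum]
  rw [sum_comm]
  simp only [Fintype.sum_prod_type, ← mul_sum, h₂.2, mul_one, h₁.2, sum_zmod_two]
  norm_num

theorem IsChannel.polarPlus {Y₁ Y₂ : Type*} [Fintype Y₁] [Fintype Y₂]
    {W₁ : ZMod 2 → Y₁ → ℝ} {W₂ : ZMod 2 → Y₂ → ℝ} (h₁ : IsChannel W₁) (h₂ : IsChannel W₂) :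
    IsChannel (polarPlus W₁ W₂) := by
  refine ⟨fun u y => mul_nonneg (mul_nonneg (by norm_num) (h₁.1 _ _)) (h₂.1 _ _), fun u => ?_⟩
  simp only [_root_.polarPlus, Fintype.sum_prod_type, sum_zmod_two, sum_add_distrib,
    ← mul_sum, ← sum_mul, h₁.2, h₂.2]
  norm_num

theorem Zparam_nonneg {Y : Type*} [Fintype Y] (W : ZMod 2 → Y → ℝ) : 0 ≤ Zparam W :=
  sum_nonneg fun _ _ => Real.sqrt_nonneg _

theorem IsChannel.Zparam_le_one {Y : Type*} [Fintype Y] {W : ZMod 2 → Y → ℝ}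
    (h : IsChannel W) : Zparam W ≤ 1 := by
  calc Zparam W ≤ ∑ y, (W 0 y + W 1 y) / 2 := by
        refine sum_le_sum fun y _ => Real.sqrt_le_iff.2 ⟨?_, ?_⟩
        · linarith [h.1 0 y, h.1 1 y]
        · nlinarith [sq_nonneg (W 0 y - W 1 y)]
    _ = 1 := by
        rw [← sum_div, sum_add_distrib, h.2, h.2]
        norm_num

theorem sqrt_mul_add_mul_le {a b c d : ℝ} (ha : 0 ≤ a) (hb : 0 ≤ b) (hc : 0 ≤ c) (hd : 0 ≤ d) :
    √((a * c + b * d) * (b * c + a * d)) ≤ √(a * b) * (c + d) + (a + b) * √(c * d) := by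
  refine Real.sqrt_le_iff.2 ⟨by positivity, ?_⟩
  have hab := Real.sq_sqrt (mul_nonneg ha hb)
  have hcd := Real.sq_sqrt (mul_nonneg hc hd)
  have hcross : 0 ≤ √(a * b) * (c + d) * ((a + b) * √(c * d)) := by positivity
  have hprod : 0 ≤ (a * b) * (c * d) := by positivity
  calc (a * c + b * d) * (b * c + a * d)
      ≤ (a * b) * (c + d) ^ 2 + (a + b) ^ 2 * (c * d) := by linarith
    _ = √(a * b) ^ 2 * (c + d) ^ 2 + (a + b) ^ 2 * √(c * d) ^ 2 := by rw [hab, hcd]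
    _ ≤ _ := by linarith

theorem Zparam_polarMinus_le {Y₁ Y₂ : Type*} [Fintype Y₁] [Fintype Y₂]
    {W₁ : ZMod 2 → Y₁ → ℝ} {W₂ : ZMod 2 → Y₂ → ℝ} (h₁ : IsChannel W₁) (h₂ : IsChannel W₂) :
    Zparam (polarMinus W₁ W₂) ≤ Zparam W₁ + Zparam W₂ := by
  calc Zparam (polarMinus W₁ W₂)
      ≤ ∑ y : Y₁ × Y₂, (1 / 2) * (√(W₁ 0 y.1 * W₁ 1 y.1) * (W₂ 0 y.2 + W₂ 1 y.2)
          + (W₁ 0 y.1 + W₁ 1 y.1) * √(W₂ 0 y.2 * W₂ 1 y.2)) := by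
        refine sum_le_sum fun y _ => ?_
        have key := sqrt_mul_add_mul_le (h₁.1 0 y.1) (h₁.1 1 y.1) (h₂.1 0 y.2) (h₂.1 1 y.2)
        have h11 : (1 : ZMod 2) + 1 = 0 := rfl
        simp only [polarMinus, sum_zmod_two, zero_add, add_zero, h11]
        rw [mul_mul_mul_comm, Real.sqrt_mul (by norm_num), Real.sqrt_mul_self (by norm_num)]
        linarith
    _ = Zparam W₁ + Zparam W₂ := by
        simp only [Zparam, Fintype.sum_prod_type, sum_add_distrib, ← mul_sum, ← sum_mul,
          h₁.2, h₂.2]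
        ring

theorem Zparam_polarPlus {Y₁ Y₂ : Type*} [Fintype Y₁] [Fintype Y₂]
    {W₁ : ZMod 2 → Y₁ → ℝ} {W₂ : ZMod 2 → Y₂ → ℝ} (h₁ : IsChannel W₁) :
    Zparam (polarPlus W₁ W₂) = Zparam W₁ * Zparam W₂ := by
  have term (u : ZMod 2) (y₁ : Y₁) (y₂ : Y₂) :
      √(polarPlus W₁ W₂ 0 (y₁, y₂, u) * polarPlus W₁ W₂ 1 (y₁, y₂, u)) =
        (1 / 2) * (√(W₁ 0 y₁ * W₁ 1 y₁) * √(W₂ 0 y₂ * W₂ 1 y₂)) := by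
    have hswap : W₁ u y₁ * W₁ (u + 1) y₁ = W₁ 0 y₁ * W₁ 1 y₁ := by
      obtain rfl | rfl : u = 0 ∨ u = 1 := by revert u; decide
      · simp
      · exact mul_comm _ _
    rw [← Real.sqrt_mul (mul_nonneg (h₁.1 _ _) (h₁.1 _ _)), ← hswap,
      show (1 / 2 : ℝ) = √(1 / 4) by
        rw [show (1 / 4 : ℝ) = (1 / 2) ^ 2 by norm_num, Real.sqrt_sq (by norm_num)],
      ← Real.sqrt_mul (by norm_num)]
    simp only [polarPlus, add_zero]
    congr 1
    ring
  simp only [Zparam, Fintype.sum_prod_type, term, sum_zmod_two, ← two_mul, sum_mul_sum]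
  refine sum_congr rfl fun _ _ => sum_congr rfl fun _ _ => ?_
  ring

/-- for any BMSC W, the minus bulk convolutional polar transform
satisfies Z(W^{-̂}) ≤ 4·Z(W). -/
theorem Zparam_convMinus_le {Y : Type*} [Fintype Y] (W : ZMod 2 → Y → ℝ)
    (hW : IsBMSC W) :
    Zparam (convMinus W) ≤ 4 * Zparam W := by
  have h := hW.1
  have hminus := Zparam_polarMinus_le h h
  have hplus := Zparam_polarPlus (W₂ := W) h
  have hconv := Zparam_polarMinus_le (h.polarMinus h) (h.polarPlus h)
  have hsq := mul_le_of_le_one_left (Zparam_nonneg W) h.Zparam_le_one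
  have hnonneg := Zparam_nonneg W
  unfold convMinus
  linarith
end

section
/- Let W be a BMSC with finite output alphabet and let p ∈ [0, 1/2] satisfy I(W) = 1 − h₂(p). Then the capacity gap created by one polar transform satisfies I(W⁺) − I(W⁻) ≥ 2·(h₂(2p(1−p)) − h₂(p)). -/
open Finset

/-- The binary entropy function (in bits). -/
noncomputable def h2 (p : ℝ) : ℝ :=
  -p * Real.logb 2 p - (1 - p) * Real.logb 2 (1 - p)

/-- The binary entropy, in nats, of a bit with bias `r`. -/
noncomputable def biasEntropy (r : ℝ) : ℝ := Real.binEntropy ((1 - r) / 2)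

lemma biasEntropy_neg (r : ℝ) : biasEntropy (-r) = biasEntropy r := by
  unfold biasEntropy
  rw [← Real.binEntropy_one_sub]
  ring_nf

lemma biasEntropy_abs (r : ℝ) : biasEntropy |r| = biasEntropy r := by
  rcases abs_choice r with h | h <;> simp [h, biasEntropy_neg]

lemma continuous_biasEntropy : Continuous biasEntropy := by
  unfold biasEntropy
  fun_prop

lemma biasEntropy_antitoneOn : AntitoneOn biasEntropy (Set.Icc 0 1) := by
  intro r hr s hs hrs
  refine Real.binEntropy_strictMonoOn.monotoneOn ?_ ?_ ?_
  · constructor <;> linarith [hs.1, hs.2]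
  · constructor <;> linarith [hr.1, hr.2]
  · linarith

lemma h2_eq_biasEntropy_div (p : ℝ) : h2 p = biasEntropy (1 - 2 * p) / Real.log 2 := by
  have h : (1 - (1 - 2 * p)) / 2 = p := by ring
  rw [h2, biasEntropy, h, Real.binEntropy_eq_negMulLog_add_negMulLog_one_sub]
  simp only [Real.logb, Real.negMulLog]
  ring

lemma artanh_eq_log_sub_log_div_two {r : ℝ} (hr : r ∈ Set.Ioo (-1 : ℝ) 1) :
    Real.artanh r = (Real.log (1 + r) - Real.log (1 - r)) / 2 := by
  rw [Real.artanh_eq_half_log ⟨hr.1.le, hr.2.le⟩,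
    Real.log_div (by linarith [hr.1]) (by linarith [hr.2])]
  ring

lemma hasDerivAt_artanh {r : ℝ} (h0 : 0 ≤ r) (h1 : r < 1) :
    HasDerivAt Real.artanh (1 / (1 - r ^ 2)) r := by
  have h2 : 1 + r ≠ 0 := by linarith
  have h3 : 1 - r ≠ 0 := by linarith
  have h4 : 1 - r ^ 2 ≠ 0 := by
    have : 1 - r ^ 2 = (1 + r) * (1 - r) := by ring
    rw [this]
    exact mul_ne_zero h2 h3
  have h := ((((hasDerivAt_id r).const_add 1).log h2).sub
    (((hasDerivAt_id r).const_sub 1).log h3)).div_const 2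
  have he : Real.artanh =ᶠ[nhds r] fun r => (Real.log (1 + id r) - Real.log (1 - id r)) / 2 := by
    filter_upwards [Ioo_mem_nhds (show -1 < r by linarith) h1] with s hs
    exact artanh_eq_log_sub_log_div_two hs
  refine (h.congr_of_eventuallyEq he).congr_deriv ?_
  simp only [id]
  field_simp
  ring

lemma hasDerivAt_biasEntropy {r : ℝ} (h0 : 0 ≤ r) (h1 : r < 1) :
    HasDerivAt biasEntropy (-Real.artanh r) r := by
  have hd : HasDerivAt (fun r : ℝ => (1 - r) / 2) (-1 / 2) r :=
    ((hasDerivAt_id r).const_sub 1).div_const 2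
  have h := (Real.hasDerivAt_binEntropy (p := (1 - r) / 2) (by linarith) (by linarith)).comp r hd
  refine h.congr_deriv ?_
  have e : 1 - (1 - r) / 2 = (1 + r) / 2 := by ring
  rw [e, Real.log_div (by linarith) (by norm_num), Real.log_div (by linarith) (by norm_num),
    artanh_eq_log_sub_log_div_two ⟨by linarith, h1⟩]
  ring

lemma hasDerivAt_one_sub_sq_mul_artanh {r : ℝ} (h0 : 0 ≤ r) (h1 : r < 1) :
    HasDerivAt (fun r => (1 - r ^ 2) * Real.artanh r) (1 - 2 * r * Real.artanh r) r := by
  have h := (((hasDerivAt_id r).pow 2).const_sub 1).mul (hasDerivAt_artanh h0 h1)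
  refine h.congr_deriv ?_
  have h4 : 1 - r ^ 2 ≠ 0 := by nlinarith
  simp only [id, Pi.pow_apply]
  field_simp
  ring

lemma concaveOn_one_sub_sq_mul_artanh :
    ConcaveOn ℝ (Set.Ico 0 1) (fun r => (1 - r ^ 2) * Real.artanh r) := by
  refine AntitoneOn.concaveOn_of_deriv (convex_Ico 0 1) ?_ ?_ ?_
  · exact fun r hr =>
      (hasDerivAt_one_sub_sq_mul_artanh hr.1 hr.2).continuousAt.continuousWithinAt
  · rw [interior_Ico]
    exact fun r hr =>
      (hasDerivAt_one_sub_sq_mul_artanh hr.1.le hr.2).differentiableAt.differentiableWithinAt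
  · rw [interior_Ico]
    intro r hr s hs hrs
    rw [(hasDerivAt_one_sub_sq_mul_artanh hr.1.le hr.2).deriv,
      (hasDerivAt_one_sub_sq_mul_artanh hs.1.le hs.2).deriv]
    have hmono := Real.artanh_le_artanh (by linarith [hr.1]) hs.2 hrs
    have := mul_le_mul hrs hmono (Real.artanh_nonneg hr.1.le) hs.1.le
    linarith

lemma mul_one_sub_sq_mul_artanh_le {c r : ℝ} (hc : c ∈ Set.Icc (0 : ℝ) 1) (h0 : 0 ≤ r)
    (h1 : r < 1) :
    c * ((1 - r ^ 2) * Real.artanh r) ≤ (1 - (c * r) ^ 2) * Real.artanh (c * r) := by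
  have h := concaveOn_one_sub_sq_mul_artanh.2 (x := r) ⟨h0, h1⟩ (y := 0) ⟨le_rfl, one_pos⟩
    hc.1 (sub_nonneg.2 hc.2) (by ring)
  simpa [Real.artanh_zero] using h

lemma antitoneOn_artanh_mul_div_artanh {c : ℝ} (hc : c ∈ Set.Icc (0 : ℝ) 1) :
    AntitoneOn (fun r => Real.artanh (c * r) / Real.artanh r) (Set.Ioo 0 1) := by
  have hd : ∀ r ∈ Set.Ioo (0 : ℝ) 1, HasDerivAt (fun r => Real.artanh (c * r) / Real.artanh r)
      ((1 / (1 - (c * r) ^ 2) * c * Real.artanh r - Real.artanh (c * r) * (1 / (1 - r ^ 2)))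
        / Real.artanh r ^ 2) r := by
    intro r hr
    have hcr : c * r < 1 := by nlinarith [hc.1, hc.2, hr.1, hr.2]
    have hlin : HasDerivAt (fun r => c * r) c r := by simpa using (hasDerivAt_id r).const_mul c
    exact ((hasDerivAt_artanh (mul_nonneg hc.1 hr.1.le) hcr).comp r hlin).div
      (hasDerivAt_artanh hr.1.le hr.2) (Real.artanh_pos hr).ne'
  refine antitoneOn_of_deriv_nonpos (convex_Ioo 0 1)
    (fun r hr => (hd r hr).continuousAt.continuousWithinAt) ?_ ?_
  · rw [interior_Ioo]
    exact fun r hr => (hd r hr).differentiableAt.differentiableWithinAt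
  · rw [interior_Ioo]
    intro r hr
    rw [(hd r hr).deriv]
    refine div_nonpos_of_nonpos_of_nonneg ?_ (sq_nonneg _)
    have hcr : c * r < 1 := by nlinarith [hc.1, hc.2, hr.1, hr.2]
    have hcr0 : 0 ≤ c * r := mul_nonneg hc.1 hr.1.le
    have hr2 : 0 < 1 - r ^ 2 := by nlinarith [hr.1, hr.2]
    have hcr2 : 0 < 1 - (c * r) ^ 2 := by nlinarith
    have key := mul_one_sub_sq_mul_artanh_le hc hr.1.le hr.2
    have e : 1 / (1 - (c * r) ^ 2) * c * Real.artanh r - Real.artanh (c * r) * (1 / (1 - r ^ 2)) =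
        (c * ((1 - r ^ 2) * Real.artanh r) - (1 - (c * r) ^ 2) * Real.artanh (c * r)) /
          ((1 - (c * r) ^ 2) * (1 - r ^ 2)) := by
      have hne : 1 - c ^ 2 * r ^ 2 ≠ 0 := by
        rw [← mul_pow]
        exact hcr2.ne'
      field_simp
    rw [e]
    exact div_nonpos_of_nonpos_of_nonneg (by linarith) (by positivity)

/-- The tangent-line form of the convexity statement behind Mrs. Gerber's lemma. -/
lemma exists_slope_biasEntropy_mul {c ρ : ℝ} (hc : c ∈ Set.Icc (0 : ℝ) 1)
    (hρ : ρ ∈ Set.Icc (0 : ℝ) 1) :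
    ∃ m : ℝ, ∀ r ∈ Set.Icc (0 : ℝ) 1,
      m * (biasEntropy r - biasEntropy ρ) ≤ biasEntropy (c * r) - biasEntropy (c * ρ) := by
  have hmem : ∀ r ∈ Set.Icc (0 : ℝ) 1, c * r ∈ Set.Icc (0 : ℝ) 1 := fun r hr =>
    ⟨mul_nonneg hc.1 hr.1, mul_le_one₀ hc.2 hr.1 hr.2⟩
  rcases hρ.1.eq_or_lt with rfl | hρ0
  · refine ⟨1, fun r hr => ?_⟩
    have := biasEntropy_antitoneOn (hmem r hr) hr (mul_le_of_le_one_left hr.1 hc.2)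
    simpa using this
  rcases hρ.2.eq_or_lt with rfl | hρ1
  · refine ⟨0, fun r hr => ?_⟩
    have := biasEntropy_antitoneOn (hmem r hr) (hmem 1 hρ) (mul_le_mul_of_nonneg_left hr.2 hc.1)
    linarith
  set k := Real.artanh (c * ρ) / Real.artanh ρ
  set D : ℝ → ℝ := fun r => biasEntropy (c * r) - c * k * biasEntropy r with hD
  have hDd : ∀ r ∈ Set.Ioo (0 : ℝ) 1,
      HasDerivAt D (c * (Real.artanh r * (k - Real.artanh (c * r) / Real.artanh r))) r := by
    intro r hr
    have hcr : c * r < 1 := by nlinarith [hc.1, hc.2, hr.1, hr.2]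
    have hlin : HasDerivAt (fun r => c * r) c r := by simpa using (hasDerivAt_id r).const_mul c
    have h := ((hasDerivAt_biasEntropy (mul_nonneg hc.1 hr.1.le) hcr).comp r hlin).sub
      ((hasDerivAt_biasEntropy hr.1.le hr.2).const_mul (c * k))
    refine h.congr_deriv ?_
    have := (Real.artanh_pos hr).ne'
    field_simp
    ring
  have hDc : Continuous D := by
    have := continuous_biasEntropy
    fun_prop
  have hanti := antitoneOn_artanh_mul_div_artanh hc
  have hmin : ∀ r ∈ Set.Icc (0 : ℝ) 1, D ρ ≤ D r := by
    intro r hr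
    rcases le_total r ρ with h | h
    · have hA : AntitoneOn D (Set.Icc 0 ρ) := by
        refine antitoneOn_of_deriv_nonpos (convex_Icc 0 ρ) hDc.continuousOn ?_ ?_ <;>
          rw [interior_Icc] <;> intro s hs
        · exact (hDd s ⟨hs.1, hs.2.trans hρ1⟩).differentiableAt.differentiableWithinAt
        · rw [(hDd s ⟨hs.1, hs.2.trans hρ1⟩).deriv]
          have := hanti ⟨hs.1, hs.2.trans hρ1⟩ ⟨hρ0, hρ1⟩ hs.2.le
          exact mul_nonpos_of_nonneg_of_nonpos hc.1 (mul_nonpos_of_nonneg_of_nonpos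
            (Real.artanh_nonneg hs.1.le) (sub_nonpos.2 this))
      exact hA ⟨hr.1, h⟩ ⟨hρ.1, le_rfl⟩ h
    · have hM : MonotoneOn D (Set.Icc ρ 1) := by
        refine monotoneOn_of_deriv_nonneg (convex_Icc ρ 1) hDc.continuousOn ?_ ?_ <;>
          rw [interior_Icc] <;> intro s hs
        · exact (hDd s ⟨hρ0.trans hs.1, hs.2⟩).differentiableAt.differentiableWithinAt
        · rw [(hDd s ⟨hρ0.trans hs.1, hs.2⟩).deriv]
          have := hanti ⟨hρ0, hρ1⟩ ⟨hρ0.trans hs.1, hs.2⟩ hs.1.le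
          exact mul_nonneg hc.1 (mul_nonneg
            (Real.artanh_nonneg (hρ0.trans hs.1).le) (sub_nonneg.2 this))
      exact hM ⟨le_rfl, hρ.2⟩ ⟨h, hr.2⟩ h
  refine ⟨c * k, fun r hr => ?_⟩
  have := hmin r hr
  simp only [hD] at this
  linarith

/-- **Mrs. Gerber's lemma** for a finite mixture of bits. -/
lemma biasEntropy_mul_le_sum {ι : Type*} [Fintype ι] {q r : ι → ℝ} {c ρ : ℝ}
    (hq : ∀ i, 0 ≤ q i) (hq1 : ∑ i, q i = 1) (hr : ∀ i, |r i| ≤ 1) (hc : |c| ≤ 1)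
    (hρ : ρ ∈ Set.Icc (0 : ℝ) 1) (h : ∑ i, q i * biasEntropy (r i) = biasEntropy ρ) :
    biasEntropy (c * ρ) ≤ ∑ i, q i * biasEntropy (c * r i) := by
  obtain ⟨m, hm⟩ := exists_slope_biasEntropy_mul ⟨abs_nonneg c, hc⟩ hρ
  have habs : ∀ s, biasEntropy (|c| * |s|) = biasEntropy (c * s) := fun s => by
    rw [← abs_mul, biasEntropy_abs]
  have hm' : ∀ i, q i * (m * (biasEntropy (r i) - biasEntropy ρ)) ≤
      q i * (biasEntropy (c * r i) - biasEntropy (c * ρ)) := fun i => by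
    have := hm |r i| ⟨abs_nonneg _, hr i⟩
    rw [biasEntropy_abs, habs, ← abs_of_nonneg hρ.1, habs, abs_of_nonneg hρ.1] at this
    exact mul_le_mul_of_nonneg_left this (hq i)
  have hsum := Finset.sum_le_sum fun i (_ : i ∈ Finset.univ) => hm' i
  have hl : ∑ i, q i * (m * (biasEntropy (r i) - biasEntropy ρ)) = 0 := by
    have : ∀ i, q i * (m * (biasEntropy (r i) - biasEntropy ρ)) =
        m * (q i * biasEntropy (r i)) - q i * (m * biasEntropy ρ) := fun i => by ring
    simp only [this, Finset.sum_sub_distrib, ← Finset.mul_sum, ← Finset.sum_mul, h, hq1]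
    ring
  simp only [mul_sub] at hsum hl
  rw [hl, Finset.sum_sub_distrib, ← Finset.sum_mul, hq1] at hsum
  linarith

/-- Twice the contribution, in nats, to the symmetric capacity of an output symbol with
likelihoods `a` and `b`. -/
noncomputable def symbolInfo (a b : ℝ) : ℝ :=
  Real.negMulLog (a + b) - Real.negMulLog a - Real.negMulLog b + (a + b) * Real.log 2

lemma mul_log_div_half_eq {a s : ℝ} (hs : a ≠ 0 → s ≠ 0) :
    a * Real.log (a / (1 / 2 * s)) =
      -Real.negMulLog a - a * Real.log s + a * Real.log 2 := by
  by_cases ha : a = 0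
  · simp [ha]
  rw [Real.log_div ha (by simpa using hs ha), Real.log_mul (by norm_num) (hs ha),
    one_div, Real.log_inv, Real.negMulLog]
  ring

lemma capacity_eq_sum_symbolInfo {Y : Type*} [Fintype Y] {W : ZMod 2 → Y → ℝ}
    (hW : ∀ x y, 0 ≤ W x y) :
    capacity W = (∑ y, symbolInfo (W 0 y) (W 1 y)) / (2 * Real.log 2) := by
  have hsum : ∀ f : ZMod 2 → ℝ, ∑ x, f x = f 0 + f 1 := fun f => Fin.sum_univ_two f
  rw [capacity, hsum, ← Finset.sum_add_distrib, Finset.sum_div]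
  refine Finset.sum_congr rfl fun y _ => ?_
  have h0 := hW 0 y
  have h1 := hW 1 y
  have e0 := mul_log_div_half_eq (a := W 0 y) (s := W 0 y + W 1 y) fun h =>
    (add_pos_of_pos_of_nonneg (h0.lt_of_ne' h) h1).ne'
  have e1 := mul_log_div_half_eq (a := W 1 y) (s := W 0 y + W 1 y) fun h =>
    (add_pos_of_nonneg_of_pos h0 (h1.lt_of_ne' h)).ne'
  have hl : Real.log 2 ≠ 0 := (Real.log_pos one_lt_two).ne'
  have e : symbolInfo (W 0 y) (W 1 y) =
      W 0 y * Real.log (W 0 y / (1 / 2 * (W 0 y + W 1 y))) +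
        W 1 y * Real.log (W 1 y / (1 / 2 * (W 0 y + W 1 y))) := by
    rw [e0, e1, symbolInfo]
    simp only [Real.negMulLog]
    ring
  rw [e]
  simp only [Real.logb]
  field_simp

lemma symbolInfo_mul (k a b : ℝ) : symbolInfo (k * a) (k * b) = k * symbolInfo a b := by
  simp only [symbolInfo, ← mul_add, Real.negMulLog_mul]
  ring

/-- The chain rule for one polar transform, at a single pair of output symbols. -/
lemma symbolInfo_polar (a b c d : ℝ) :
    symbolInfo (a * c) (b * d) + symbolInfo (b * c) (a * d) +
        symbolInfo (a * c + b * d) (b * c + a * d) =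
      (a + b) * symbolInfo c d + (c + d) * symbolInfo a b := by
  have h : a * c + b * d + (b * c + a * d) = (a + b) * (c + d) := by ring
  simp only [symbolInfo, h, Real.negMulLog_mul]
  ring

lemma symbolInfo_eq_biasEntropy {a b : ℝ} (ha : 0 ≤ a) (hb : 0 ≤ b) :
    symbolInfo a b = (a + b) * (Real.log 2 - biasEntropy ((a - b) / (a + b))) := by
  by_cases hs : a + b = 0
  · obtain ⟨rfl, rfl⟩ := (add_eq_zero_iff_of_nonneg ha hb).1 hs
    simp [symbolInfo]
  have e1 : (1 - (a - b) / (a + b)) / 2 = b / (a + b) := by field_simp; ring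
  have e2 : 1 - b / (a + b) = a / (a + b) := by field_simp; ring
  have ha' := Real.negMulLog_mul (a + b) (a / (a + b))
  have hb' := Real.negMulLog_mul (a + b) (b / (a + b))
  rw [mul_div_cancel₀ _ hs] at ha' hb'
  rw [biasEntropy, e1, Real.binEntropy_eq_negMulLog_add_negMulLog_one_sub, e2, symbolInfo,
    ha', hb']
  field_simp
  ring

/-- The probability of the output symbol `y` under a uniform input. -/
noncomputable def outputProb {Y : Type*} (W : ZMod 2 → Y → ℝ) (y : Y) : ℝ :=
  (W 0 y + W 1 y) / 2

/-- The bias of the posterior distribution of a uniform input given the output symbol `y`. -/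
noncomputable def outputBias {Y : Type*} (W : ZMod 2 → Y → ℝ) (y : Y) : ℝ :=
  (W 0 y - W 1 y) / (W 0 y + W 1 y)

section Polarization

variable {Y : Type*} [Fintype Y] {W : ZMod 2 → Y → ℝ}

lemma sum_outputProb (hW : IsChannel W) : ∑ y, outputProb W y = 1 := by
  simp only [outputProb, ← Finset.sum_div, Finset.sum_add_distrib, hW.2]
  norm_num

lemma outputProb_nonneg (hW : IsChannel W) (y : Y) : 0 ≤ outputProb W y := by
  have := hW.1 0 y
  have := hW.1 1 y
  unfold outputProb
  positivity

lemma abs_outputBias_le_one (hW : IsChannel W) (y : Y) : |outputBias W y| ≤ 1 := by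
  have h0 := hW.1 0 y
  have h1 := hW.1 1 y
  rw [outputBias, abs_div, abs_of_nonneg (add_nonneg h0 h1)]
  refine div_le_one_of_le₀ (abs_le.2 ⟨?_, ?_⟩) (add_nonneg h0 h1) <;> linarith

lemma capacity_eq_one_sub (hW : IsChannel W) :
    capacity W = 1 - (∑ y, outputProb W y * biasEntropy (outputBias W y)) / Real.log 2 := by
  have hl : Real.log 2 ≠ 0 := (Real.log_pos one_lt_two).ne'
  have e : ∀ y, symbolInfo (W 0 y) (W 1 y) =
      2 * (outputProb W y * Real.log 2 - outputProb W y * biasEntropy (outputBias W y)) := by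
    intro y
    rw [symbolInfo_eq_biasEntropy (hW.1 0 y) (hW.1 1 y), outputProb, outputBias]
    ring
  simp only [capacity_eq_sum_symbolInfo hW.1, e, ← Finset.mul_sum, Finset.sum_sub_distrib,
    ← Finset.sum_mul, sum_outputProb hW]
  field_simp

lemma polarMinus_zero (W : ZMod 2 → Y → ℝ) (y : Y × Y) :
    polarMinus W W 0 y = 1 / 2 * (W 0 y.1 * W 0 y.2 + W 1 y.1 * W 1 y.2) := by
  have hsum : ∀ f : ZMod 2 → ℝ, ∑ x, f x = f 0 + f 1 := fun f => Fin.sum_univ_two f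
  simp [polarMinus, hsum]

lemma polarMinus_one (W : ZMod 2 → Y → ℝ) (y : Y × Y) :
    polarMinus W W 1 y = 1 / 2 * (W 1 y.1 * W 0 y.2 + W 0 y.1 * W 1 y.2) := by
  have hsum : ∀ f : ZMod 2 → ℝ, ∑ x, f x = f 0 + f 1 := fun f => Fin.sum_univ_two f
  have h : (1 : ZMod 2) + 1 = 0 := rfl
  simp [polarMinus, hsum, h]

lemma isChannel_polarMinus (hW : IsChannel W) : IsChannel (polarMinus W W) := by
  refine ⟨fun u y => mul_nonneg (by norm_num) (Finset.sum_nonneg fun v _ =>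
    mul_nonneg (hW.1 _ _) (hW.1 _ _)), fun u => ?_⟩
  simp only [polarMinus, ← Finset.mul_sum]
  rw [Finset.sum_comm]
  simp only [Fintype.sum_prod_type, ← Finset.mul_sum, ← Finset.sum_mul, hW.2]
  simp

lemma outputProb_polarMinus (W : ZMod 2 → Y → ℝ) (y : Y × Y) :
    outputProb (polarMinus W W) y = outputProb W y.1 * outputProb W y.2 := by
  simp only [outputProb, polarMinus_zero, polarMinus_one]
  ring

lemma outputBias_polarMinus (W : ZMod 2 → Y → ℝ) (y : Y × Y) :
    outputBias (polarMinus W W) y = outputBias W y.1 * outputBias W y.2 := by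
  simp only [outputBias, polarMinus_zero, polarMinus_one, ← mul_sub, ← mul_add]
  rw [mul_div_mul_left _ _ (by norm_num), div_mul_div_comm]
  congr 1 <;> ring

/-- The polar transform preserves the total symmetric capacity. -/
lemma capacity_polarPlus_add_capacity_polarMinus (hW : IsChannel W) :
    capacity (polarPlus W W) + capacity (polarMinus W W) = 2 * capacity W := by
  have hplus : ∀ x y, 0 ≤ polarPlus W W x y := fun x y =>
    mul_nonneg (mul_nonneg (by norm_num) (hW.1 _ _)) (hW.1 _ _)
  have hsum : ∀ f : ZMod 2 → ℝ, ∑ x, f x = f 0 + f 1 := fun f => Fin.sum_univ_two f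
  have h : (1 : ZMod 2) + 1 = 0 := rfl
  rw [capacity_eq_sum_symbolInfo hplus, capacity_eq_sum_symbolInfo (isChannel_polarMinus hW).1,
    capacity_eq_sum_symbolInfo hW.1, ← add_div, ← mul_div_assoc]
  congr 1
  have e : ∀ y₁ y₂, symbolInfo (polarPlus W W 0 (y₁, y₂, 0)) (polarPlus W W 1 (y₁, y₂, 0)) +
      symbolInfo (polarPlus W W 0 (y₁, y₂, 1)) (polarPlus W W 1 (y₁, y₂, 1)) +
      symbolInfo (polarMinus W W 0 (y₁, y₂)) (polarMinus W W 1 (y₁, y₂)) =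
      outputProb W y₁ * symbolInfo (W 0 y₂) (W 1 y₂) +
        symbolInfo (W 0 y₁) (W 1 y₁) * outputProb W y₂ := by
    intro y₁ y₂
    simp only [polarMinus_zero, polarMinus_one, polarPlus, h, add_zero, zero_add, mul_assoc,
      symbolInfo_mul, ← mul_add]
    rw [symbolInfo_polar]
    unfold outputProb
    ring
  simp only [Fintype.sum_prod_type, hsum, ← Finset.sum_add_distrib, e]
  simp only [Finset.sum_add_distrib, ← Finset.mul_sum, ← Finset.sum_mul, sum_outputProb hW]
  ring

end Polarization

/-- if W is a BMSC with I(W) = 1 − h₂(p) for p ∈ [0,1/2], then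
I(W⁺) − I(W⁻) ≥ 2·(h₂(2p(1−p)) − h₂(p)). -/
theorem polar_gap_lower_bound {Y : Type*} [Fintype Y] (W : ZMod 2 → Y → ℝ)
    (hW : IsBMSC W) (p : ℝ) (hp : p ∈ Set.Icc (0 : ℝ) (1 / 2))
    (hI : capacity W = 1 - h2 p) :
    2 * (h2 (2 * p * (1 - p)) - h2 p) ≤
      capacity (polarPlus W W) - capacity (polarMinus W W) := by
  have hC := hW.1
  have hl : 0 < Real.log 2 := Real.log_pos one_lt_two
  have hρ : 1 - 2 * p ∈ Set.Icc (0 : ℝ) 1 := ⟨by linarith [hp.2], by linarith [hp.1]⟩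
  have hH : ∑ y, outputProb W y * biasEntropy (outputBias W y) = biasEntropy (1 - 2 * p) := by
    rw [capacity_eq_one_sub hC, h2_eq_biasEntropy_div] at hI
    exact (div_left_inj' hl.ne').1 (by linarith)
  have hmix : ∀ c : ℝ, |c| ≤ 1 → biasEntropy (c * (1 - 2 * p)) ≤
      ∑ y, outputProb W y * biasEntropy (c * outputBias W y) := fun c hc =>
    biasEntropy_mul_le_sum (outputProb_nonneg hC) (sum_outputProb hC) (abs_outputBias_le_one hC)
      hc hρ hH
  have hminus : biasEntropy (1 - 2 * (2 * p * (1 - p))) ≤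
      ∑ y, outputProb (polarMinus W W) y * biasEntropy (outputBias (polarMinus W W) y) := by
    have e : 1 - 2 * (2 * p * (1 - p)) = (1 - 2 * p) * (1 - 2 * p) := by ring
    rw [e]
    simp only [outputProb_polarMinus, outputBias_polarMinus, Fintype.sum_prod_type, mul_assoc,
      ← Finset.mul_sum]
    refine (hmix _ (abs_le.2 ⟨by linarith [hρ.1], hρ.2⟩)).trans ?_
    refine Finset.sum_le_sum fun y _ => mul_le_mul_of_nonneg_left ?_ (outputProb_nonneg hC y)
    rw [mul_comm]
    exact hmix _ (abs_outputBias_le_one hC y)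
  have hdiv := div_le_div_of_nonneg_right hminus hl.le
  have hcons := capacity_polarPlus_add_capacity_polarMinus hC
  rw [hI] at hcons
  rw [← h2_eq_biasEntropy_div] at hdiv
  linarith [capacity_eq_one_sub (isChannel_polarMinus hC)]
end
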